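/- Suppose T is disjoint from its image under the involution * (i.e. T ∩ T* = ∅) and σ₁* ∈ T. Then a₁ = (a_T − 1)/f and a_j = a_T/f for every 2 ≤ j ≤ n; that is, the μ-ordinary slopes attached to T are (a_T − 1)/f with multiplicity f and a_T/f with multiplicity (n−1)f. -/

import Mathlib

/-- The composite `σ* = conj ∘ σ` of a complex embedding with complex conjugation. -/
def conjEmb {F : Type*} [Field F] (σ : F →+* ℂ) : F →+* ℂ :=
  (starRingEnd ℂ).comp σ

theorem conjEmb_conjEmb {F : Type*} [Field F] (σ : F →+* ℂ) : conjEmb (conjEmb σ) = σ := by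
  ext x
  simp [conjEmb]

/-- Let `F` be a totally complex number field, `Φ` a CM type of `F`,
`σ₁ ∈ Φ`, `n ≥ 1`, and let `𝔣` be the simple signature.  Let `T` be a nonempty finite set of
complex embeddings of `F` of cardinality `f` with `T ∩ T* = ∅` and `σ₁* ∈ T`.  Writing
`a_T = #(Φ* ∩ T)`, the μ-ordinary slopes `a_j = #{σ ∈ T : 𝔣(σ) > n − j} / f` attached to `T`
satisfy `a₁ = (a_T − 1)/f` and `a_j = a_T / f` for `2 ≤ j ≤ n`; i.e. the slopes are
`(a_T−1)/f` with multiplicity `f` and `a_T/f` with multiplicity `(n−1)f`. -/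
theorem stmt_5 (F : Type*) [Field F] [NumberField F] [DecidableEq (F →+* ℂ)]
    (htc : ∀ σ : F →+* ℂ, conjEmb σ ≠ σ)
    (Φ : Finset (F →+* ℂ))
    (hΦ : ∀ σ : F →+* ℂ, Xor' (σ ∈ Φ) (conjEmb σ ∈ Φ))
    (σ₁ : F →+* ℂ) (hσ₁ : σ₁ ∈ Φ)
    (n : ℕ) (hn : 1 ≤ n)
    (𝔣 : (F →+* ℂ) → ℤ)
    (h𝔣σ₁ : 𝔣 σ₁ = 1)
    (h𝔣Φ : ∀ σ ∈ Φ, σ ≠ σ₁ → 𝔣 σ = 0)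
    (h𝔣σ₁c : 𝔣 (conjEmb σ₁) = (n : ℤ) - 1)
    (h𝔣Φc : ∀ σ ∈ Φ, σ ≠ σ₁ → 𝔣 (conjEmb σ) = (n : ℤ))
    (T : Finset (F →+* ℂ)) (hT : T.Nonempty) (f : ℕ) (hf : T.card = f)
    (hTdisj : T ∩ T.image conjEmb = ∅)
    (hσ₁cT : conjEmb σ₁ ∈ T) :
    (((T.filter fun σ => (n : ℤ) - (1 : ℤ) < 𝔣 σ).card : ℚ) / (f : ℚ)) =
      (((Φ.image conjEmb ∩ T).card : ℚ) - 1) / (f : ℚ) ∧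
    (∀ j : ℕ, 2 ≤ j → j ≤ n →
      (((T.filter fun σ => (n : ℤ) - (j : ℤ) < 𝔣 σ).card : ℚ) / (f : ℚ)) =
        ((Φ.image conjEmb ∩ T).card : ℚ) / (f : ℚ)) := by
  have hσ₁T : σ₁ ∉ T := fun h => by
    have : conjEmb σ₁ ∈ T ∩ T.image conjEmb :=
      Finset.mem_inter.2 ⟨hσ₁cT, Finset.mem_image_of_mem _ h⟩
    simp [hTdisj] at this
  have mem_image (σ : F →+* ℂ) : σ ∈ Φ.image conjEmb ↔ conjEmb σ ∈ Φ := by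
    rw [Finset.mem_image]
    constructor
    · rintro ⟨τ, hτ, rfl⟩
      rwa [conjEmb_conjEmb]
    · exact fun h => ⟨_, h, conjEmb_conjEmb σ⟩
  have value_of_mem (σ : F →+* ℂ) (hσ : σ ∈ T) (h : conjEmb σ ∉ Φ) : 𝔣 σ = 0 := by
    have hσΦ : σ ∈ Φ := by
      rcases hΦ σ with h' | h'
      · exact h'.1
      · exact absurd h'.1 h
    exact h𝔣Φ σ hσΦ fun e => hσ₁T (e ▸ hσ)
  have value_of_conj_mem (σ : F →+* ℂ) (h : conjEmb σ ∈ Φ) (hne : σ ≠ conjEmb σ₁) :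
      𝔣 σ = n := by
    have := h𝔣Φc _ h fun e => hne (by rw [← e, conjEmb_conjEmb])
    rwa [conjEmb_conjEmb] at this
  have conj_mem : conjEmb σ₁ ∈ Φ.image conjEmb ∩ T :=
    Finset.mem_inter.2 ⟨Finset.mem_image_of_mem _ hσ₁, hσ₁cT⟩
  constructor
  · have filter_eq : (T.filter fun σ => (n : ℤ) - (1 : ℤ) < 𝔣 σ) =
        (Φ.image conjEmb ∩ T).erase (conjEmb σ₁) := by
      ext σ
      rw [Finset.mem_filter, Finset.mem_erase, Finset.mem_inter, mem_image]
      constructor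
      · rintro ⟨hσ, hlt⟩
        refine ⟨?_, ?_, hσ⟩
        · rintro rfl
          omega
        · by_contra h
          have := value_of_mem σ hσ h
          omega
      · rintro ⟨hne, h, hσ⟩
        have := value_of_conj_mem σ h hne
        exact ⟨hσ, by omega⟩
    rw [filter_eq, Finset.cast_card_erase_of_mem conj_mem]
  · intro j hj hjn
    have filter_eq : (T.filter fun σ => (n : ℤ) - (j : ℤ) < 𝔣 σ) = Φ.image conjEmb ∩ T := by
      ext σ
      rw [Finset.mem_filter, Finset.mem_inter, mem_image]
      constructor
      · rintro ⟨hσ, hlt⟩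
        refine ⟨?_, hσ⟩
        by_contra h
        have := value_of_mem σ hσ h
        omega
      · rintro ⟨h, hσ⟩
        refine ⟨hσ, ?_⟩
        by_cases hne : σ = conjEmb σ₁
        · rw [hne]
          omega
        · have := value_of_conj_mem σ h hne
          omega
    rw [filter_eq]
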